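/- arXiv:2209.00434 — 2 statements merged into one kernel-verified Lean document; each statement's English description precedes it below -/
import Mathlib

section
/- Let N be an even natural number and p a natural number with 1 ≤ p and 4p ≤ N. Let A : Fin N → ℂ be a sequence whose discrete Fourier coefficients satisfy A_q = 0 for all q with p ≤ q ≤ N - p (a low-pass amplitude). Then the discrete Hilbert transform of the amplitude-modulated cosine satisfies H_d(k ↦ A[k]·cos(ω_p k))[k] = A[k]·sin(ω_p k) for all k. In particular, the analytic signal of k ↦ A[k]·cos(ω_p k) equals k ↦ A[k]·exp(i ω_p k), so the Hilbert transform method perfectly reconstructs the phase of a signal with slow amplitude modulation. -/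
/-- Discrete Fourier coefficients: `X_n = (1/N) ∑_{k=0}^{N-1} x[k] exp(-2πi n k / N)`. -/
noncomputable def dft (N : ℕ) (x : Fin N → ℂ) (n : Fin N) : ℂ :=
  (1 / (N : ℂ)) * ∑ k : Fin N, x k *
    Complex.exp (-2 * (Real.pi : ℂ) * Complex.I * (n.val : ℂ) * (k.val : ℂ) / (N : ℂ))

/-- Sign sequence of the discrete Hilbert transform: `S_0 = 0`, `S_n = 1` for
`1 ≤ n ≤ N/2`, and `S_n = -1` for `N/2 + 1 ≤ n ≤ N - 1`. -/
noncomputable def dhtSign (N : ℕ) (n : Fin N) : ℂ :=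
  if n.val = 0 then 0 else if n.val ≤ N / 2 then 1 else -1

/-- Discrete Hilbert transform: `(H_d x)[k] = ∑_{n=0}^{N-1} (-i S_n) X_n exp(2πi n k / N)`. -/
noncomputable def dht (N : ℕ) (x : Fin N → ℂ) (k : Fin N) : ℂ :=
  ∑ n : Fin N, (-Complex.I * dhtSign N n) * dft N x n *
    Complex.exp (2 * (Real.pi : ℂ) * Complex.I * (n.val : ℂ) * (k.val : ℂ) / (N : ℂ))

/-- Fourier coefficients indexed by all integers. -/
noncomputable def dftZ (N : ℕ) (x : Fin N → ℂ) (m : ℤ) : ℂ :=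
  (1 / (N : ℂ)) * ∑ k : Fin N, x k *
    Complex.exp (-2 * (Real.pi : ℂ) * Complex.I * (m : ℂ) * (k.val : ℂ) / (N : ℂ))

lemma dft_eq_dftZ (N : ℕ) (x : Fin N → ℂ) (n : Fin N) : dft N x n = dftZ N x (n.val : ℤ) := by
  simp [dft, dftZ]

lemma dftZ_sub_period (N : ℕ) (hN : N ≠ 0) (x : Fin N → ℂ) (m : ℤ) :
    dftZ N x (m + N) = dftZ N x m := by
  have hN' : (N : ℂ) ≠ 0 := by exact_mod_cast hN
  unfold dftZ
  congr 1
  refine Finset.sum_congr rfl fun k _ => ?_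
  congr 1
  rw [Complex.exp_eq_exp_iff_exists_int]
  refine ⟨-(k.val : ℤ), ?_⟩
  push_cast
  field_simp
  ring

lemma orth (N : ℕ) (hN : N ≠ 0) (j k : Fin N) :
    ∑ n : Fin N, Complex.exp (-2 * (Real.pi : ℂ) * Complex.I * (n.val : ℂ) * (j.val : ℂ) / (N : ℂ)) *
      Complex.exp (2 * (Real.pi : ℂ) * Complex.I * (n.val : ℂ) * (k.val : ℂ) / (N : ℂ)) =
      if j = k then (N : ℂ) else 0 := by
  have hN' : (N : ℂ) ≠ 0 := by exact_mod_cast hN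
  split_ifs with h
  · subst h
    rw [Finset.sum_congr rfl (g := fun _ => (1 : ℂ))]
    · simp
    · intro n _
      rw [← Complex.exp_add, ← Complex.exp_zero]
      congr 1
      ring
  · set w : ℂ := Complex.exp (2 * (Real.pi : ℂ) * Complex.I * ((k.val : ℂ) - (j.val : ℂ)) / (N : ℂ))
      with hw
    have h1 : ∀ n : Fin N,
        Complex.exp (-2 * (Real.pi : ℂ) * Complex.I * (n.val : ℂ) * (j.val : ℂ) / (N : ℂ)) *
        Complex.exp (2 * (Real.pi : ℂ) * Complex.I * (n.val : ℂ) * (k.val : ℂ) / (N : ℂ)) =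
        w ^ n.val := by
      intro n
      rw [← Complex.exp_add, hw, ← Complex.exp_nat_mul]
      congr 1
      ring
    simp only [h1]
    rw [Fin.sum_univ_eq_sum_range (fun n => w ^ n) N]
    have hw1 : w ≠ 1 := by
      intro h2
      rw [hw, Complex.exp_eq_one_iff] at h2
      obtain ⟨z, hz⟩ := h2
      have hpi : (2 * (Real.pi : ℂ) * Complex.I) ≠ 0 := Complex.two_pi_I_ne_zero
      have h3 : (k.val : ℂ) - j.val = z * N := by
        rw [div_eq_iff hN'] at hz
        apply mul_left_cancel₀ hpi
        rw [hz]; ring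
      have h4 : (k.val : ℤ) - j.val = z * N := by exact_mod_cast h3
      have hk := k.isLt
      have hj := j.isLt
      apply h
      apply Fin.ext
      have h5 : (k.val : ℤ) - j.val = 0 := by
        apply Int.eq_zero_of_abs_lt_dvd (m := (N : ℤ)) ⟨z, by rw [h4]; ring⟩
        rw [abs_lt]; constructor <;> omega
      omega
    have hwN : w ^ N = 1 := by
      rw [hw, ← Complex.exp_nat_mul, Complex.exp_eq_one_iff]
      refine ⟨(k.val : ℤ) - j.val, ?_⟩
      push_cast
      field_simp
    rw [geom_sum_eq hw1, hwN]; simp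

lemma dft_inv (N : ℕ) (hN : N ≠ 0) (x : Fin N → ℂ) (k : Fin N) :
    ∑ n : Fin N, dft N x n *
      Complex.exp (2 * (Real.pi : ℂ) * Complex.I * (n.val : ℂ) * (k.val : ℂ) / (N : ℂ)) = x k := by
  have hN' : (N : ℂ) ≠ 0 := by exact_mod_cast hN
  simp only [dft, mul_assoc (1 / (N : ℂ)), Finset.sum_mul]
  rw [← Finset.mul_sum, Finset.sum_comm]
  simp only [mul_assoc (x _)]
  simp only [← Finset.mul_sum, orth N hN]
  simp
  field_simp

lemma dftZ_shift (N : ℕ) (p : ℤ) (x : Fin N → ℂ) (m : ℤ) :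
    dftZ N x (m - p) = dftZ N (fun k => x k *
      Complex.exp (((2 * Real.pi * p / N * k.val : ℝ) : ℂ) * Complex.I)) m := by
  unfold dftZ
  congr 1
  refine Finset.sum_congr rfl fun k _ => ?_
  simp only []
  rw [mul_assoc (x k), ← Complex.exp_add]
  congr 2
  push_cast
  ring

lemma dftZ_cos (N p : ℕ) (A : Fin N → ℂ) (m : ℤ) :
    dftZ N (fun k' => A k' * ((Real.cos (2 * Real.pi * p / N * k'.val) : ℝ) : ℂ)) m =
      (dftZ N A (m - p) + dftZ N A (m + p)) / 2 := by
  have h : m + (p : ℤ) = m - (-(p : ℤ)) := by ring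
  rw [h, dftZ_shift, dftZ_shift]
  unfold dftZ
  simp only [Finset.mul_sum, ← Finset.sum_add_distrib, Finset.sum_div]
  refine Finset.sum_congr rfl fun k _ => ?_
  rw [Complex.ofReal_cos, Complex.cos]
  push_cast
  ring_nf

lemma dftZ_sin (N p : ℕ) (A : Fin N → ℂ) (m : ℤ) :
    dftZ N (fun k' => A k' * ((Real.sin (2 * Real.pi * p / N * k'.val) : ℝ) : ℂ)) m =
      -Complex.I * (dftZ N A (m - p) - dftZ N A (m + p)) / 2 := by
  have h : m + (p : ℤ) = m - (-(p : ℤ)) := by ring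
  rw [h, dftZ_shift, dftZ_shift]
  unfold dftZ
  simp only [Finset.mul_sum, ← Finset.sum_sub_distrib, Finset.sum_div]
  refine Finset.sum_congr rfl fun k _ => ?_
  rw [Complex.ofReal_sin, Complex.sin]
  push_cast
  ring_nf

/-- For a low-pass amplitude `A` (Fourier coefficients `A_q = 0` for `p ≤ q ≤ N - p`),
the discrete Hilbert transform of the amplitude-modulated cosine `k ↦ A[k] cos(ω_p k)`
is `k ↦ A[k] sin(ω_p k)`; in particular its analytic signal is `k ↦ A[k] exp(i ω_p k)`,
so the Hilbert transform method perfectly reconstructs the phase of a signal with slow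
amplitude modulation. -/
theorem dht_slow_amplitude (N : ℕ) (hNeven : Even N) (p : ℕ) (hp : 1 ≤ p)
    (hpN : 4 * p ≤ N) (A : Fin N → ℂ)
    (hA : ∀ q : Fin N, p ≤ q.val → q.val ≤ N - p → dft N A q = 0) :
    ∀ k : Fin N,
      dht N (fun k' => A k' * ((Real.cos (2 * Real.pi * p / N * k'.val) : ℝ) : ℂ)) k =
        A k * ((Real.sin (2 * Real.pi * p / N * k.val) : ℝ) : ℂ) ∧
      A k * ((Real.cos (2 * Real.pi * p / N * k.val) : ℝ) : ℂ) +
          Complex.I *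
            dht N (fun k' => A k' * ((Real.cos (2 * Real.pi * p / N * k'.val) : ℝ) : ℂ)) k =
        A k * Complex.exp (Complex.I * ((2 * Real.pi * p / N : ℝ) : ℂ) * (k.val : ℂ)) := by
  have hN : N ≠ 0 := by omega
  have hZ : ∀ m : ℤ, (p : ℤ) ≤ m → m ≤ (N : ℤ) - p → dftZ N A m = 0 := by
    intro m h1 h2
    have h := hA ⟨m.toNat, by omega⟩ (by simp only; omega) (by simp only; omega)
    rw [dft_eq_dftZ] at h
    simp only at h
    rwa [Int.toNat_of_nonneg (by omega)] at h
  have key : ∀ n : Fin N, (-Complex.I * dhtSign N n) *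
      dft N (fun k' => A k' * ((Real.cos (2 * Real.pi * p / N * k'.val) : ℝ) : ℂ)) n =
      dft N (fun k' => A k' * ((Real.sin (2 * Real.pi * p / N * k'.val) : ℝ) : ℂ)) n := by
    intro n
    have hn := n.isLt
    rw [dft_eq_dftZ, dft_eq_dftZ, dftZ_cos, dftZ_sin]
    unfold dhtSign
    split_ifs with h0 h1
    · rw [hZ (n.val + p) (by omega) (by omega), ← dftZ_sub_period N hN A (n.val - p),
        hZ (n.val - p + N) (by omega) (by omega)]
      simp
    · rw [hZ (n.val + p) (by omega) (by omega)]
      ring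
    · rw [hZ (n.val - p) (by omega) (by omega)]
      ring
  intro k
  have hmain : dht N (fun k' => A k' * ((Real.cos (2 * Real.pi * p / N * k'.val) : ℝ) : ℂ)) k =
      A k * ((Real.sin (2 * Real.pi * p / N * k.val) : ℝ) : ℂ) := by
    unfold dht
    simp only [key]
    exact dft_inv N hN _ k
  refine ⟨hmain, ?_⟩
  rw [hmain]
  have he : Complex.I * ((2 * Real.pi * p / N : ℝ) : ℂ) * (k.val : ℂ) =
      ((2 * Real.pi * p / N * k.val : ℝ) : ℂ) * Complex.I := by
    push_cast
    ring
  rw [he, Complex.exp_mul_I, Complex.ofReal_cos, Complex.ofReal_sin]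
  ring
end

section
/- (The linearized Hilbert-transform phase reconstruction is exact on low-frequency components.) Let N be an even natural number and m a natural number with 1 ≤ m and 4m < N. Let n be a natural number with 0 ≤ n ≤ m-1 and c ∈ ℂ, and let v[k] = c·exp(i k ω_n) + conj(c)·exp(-i k ω_n) (a real-valued sequence). Then f(v)[k] = v[k] for all k. -/
/-- The linearized Hilbert-transform phase-reconstruction operator: for a real sequence
`u`, `f(u)[k] = -Im[exp(-i ω_m k) (u[k] sin(ω_m k) + i H_d(k' ↦ u[k'] sin(ω_m k'))[k])]`,
where `ω_m = 2πm/N`. It is the first-order (in the modulation amplitude) approximation of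
the phase-modulation reconstructed by the Hilbert transform method. -/
noncomputable def linRec (N m : ℕ) (u : Fin N → ℝ) (k : Fin N) : ℝ :=
  -(Complex.exp (-Complex.I * ((2 * Real.pi * m / N : ℝ) : ℂ) * (k.val : ℂ)) *
      (((u k * Real.sin (2 * Real.pi * m / N * k.val) : ℝ) : ℂ) +
        Complex.I *
          dht N (fun k' => ((u k' * Real.sin (2 * Real.pi * m / N * k'.val) : ℝ) : ℂ)) k)).im

noncomputable def Emode (N : ℕ) (a : ℤ) (k : ℕ) : ℂ :=
  Complex.exp (2 * (Real.pi : ℂ) * Complex.I * (a : ℂ) * (k : ℂ) / (N : ℂ))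

theorem Emode_add (N : ℕ) (a b : ℤ) (k : ℕ) :
    Emode N (a + b) k = Emode N a k * Emode N b k := by
  unfold Emode
  rw [← Complex.exp_add]
  congr 1
  push_cast
  ring

theorem Emode_period (N : ℕ) (hN : N ≠ 0) (a : ℤ) (k : ℕ) (h : (N : ℤ) ∣ a) :
    Emode N a k = 1 := by
  obtain ⟨t, rfl⟩ := h
  unfold Emode
  rw [Complex.exp_eq_one_iff]
  have : (N : ℂ) ≠ 0 := by exact_mod_cast hN
  refine ⟨t * k, ?_⟩
  push_cast
  field_simp

theorem Emode_sum (N : ℕ) (hN : N ≠ 0) (a : ℤ) :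
    ∑ k : Fin N, Emode N a k.val = if (N : ℤ) ∣ a then (N : ℂ) else 0 := by
  have hN' : (N : ℂ) ≠ 0 := by exact_mod_cast hN
  split_ifs with h
  · simp [Emode_period N hN a _ h]
  · rw [Fin.sum_univ_eq_sum_range (fun k => Emode N a k) N]
    have hp : ∀ k : ℕ, Emode N a k = (Emode N a 1) ^ k := by
      intro k
      unfold Emode
      rw [← Complex.exp_nat_mul]
      congr 1
      push_cast
      ring
    have h1 : Emode N a 1 ≠ 1 := by
      intro h1
      unfold Emode at h1
      rw [Complex.exp_eq_one_iff] at h1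
      obtain ⟨t, ht⟩ := h1
      apply h
      refine ⟨t, ?_⟩
      have hpi : (2 * (Real.pi : ℂ) * Complex.I) ≠ 0 := Complex.two_pi_I_ne_zero
      have h2 : (2 * (Real.pi : ℂ) * Complex.I) * (a : ℂ)
          = (2 * (Real.pi : ℂ) * Complex.I) * (N * t) := by
        rw [div_eq_iff hN'] at ht
        push_cast at ht
        linear_combination ht
      have h3 := mul_left_cancel₀ hpi h2
      exact_mod_cast h3
    have hNp : (Emode N a 1) ^ N = 1 := by
      rw [← hp]
      unfold Emode
      rw [Complex.exp_eq_one_iff]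
      refine ⟨a, ?_⟩
      field_simp
    rw [Finset.sum_congr rfl (fun k _ => hp k), geom_sum_eq h1, hNp]
    simp

theorem dft_Emode (N : ℕ) (hN : N ≠ 0) (a : ℤ) (n : Fin N) :
    dft N (fun k => Emode N a k.val) n = if (N : ℤ) ∣ a - n.val then 1 else 0 := by
  have hN' : (N : ℂ) ≠ 0 := by exact_mod_cast hN
  unfold dft
  have : ∀ k : Fin N, Emode N a k.val *
      Complex.exp (-2 * (Real.pi : ℂ) * Complex.I * (n.val : ℂ) * (k.val : ℂ) / (N : ℂ))
      = Emode N (a - n.val) k.val := by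
    intro k
    rw [sub_eq_add_neg, Emode_add]
    congr 1
    unfold Emode
    congr 1
    push_cast
    ring
  rw [Finset.sum_congr rfl (fun k _ => this k), Emode_sum N hN]
  split_ifs <;> simp [hN']

theorem dht_Emode (N : ℕ) (hN : N ≠ 0) (a : ℤ) (p : Fin N) (hp : (N : ℤ) ∣ a - p.val)
    (k : Fin N) :
    dht N (fun k => Emode N a k.val) k = -Complex.I * dhtSign N p * Emode N a k.val := by
  unfold dht
  rw [Finset.sum_eq_single p]
  · rw [dft_Emode N hN, if_pos hp]
    have h1 := Emode_add N (a - p.val) p.val k.val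
    rw [Emode_period N hN _ _ hp, sub_add_cancel] at h1
    rw [h1]
    unfold Emode
    push_cast
    ring
  · intro b _ hb
    rw [dft_Emode N hN, if_neg]
    · ring
    · intro h
      apply hb
      have h2 := dvd_sub hp h
      have h3 : (N : ℤ) ∣ (b.val : ℤ) - p.val := by
        have h5 : (b.val : ℤ) - p.val = (a - p.val) - (a - b.val) := by ring
        rw [h5]
        exact h2
      have h4 := Int.eq_zero_of_abs_lt_dvd h3 (by
        have := b.isLt
        have := p.isLt
        rw [abs_lt]
        omega)
      ext
      omega
  · simp

theorem dht_pos (N : ℕ) (a : ℤ) (h0 : 0 < a) (h1 : 2 * a < N) (k : Fin N) :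
    dht N (fun k => Emode N a k.val) k = -Complex.I * Emode N a k.val := by
  lift a to ℕ using h0.le
  rw [dht_Emode N (by omega) a ⟨a, by omega⟩ (by simp)]
  have : dhtSign N ⟨a, by omega⟩ = 1 := by
    unfold dhtSign
    rw [if_neg (by simp; omega), if_pos (by simp; omega)]
  rw [this]
  ring

theorem dht_neg (N : ℕ) (a : ℤ) (h0 : 0 < a) (h1 : 2 * a < N) (k : Fin N) :
    dht N (fun k => Emode N (-a) k.val) k = Complex.I * Emode N (-a) k.val := by
  lift a to ℕ using h0.le
  rw [dht_Emode N (by omega) _ ⟨N - a, by omega⟩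
    ⟨-1, by
      have : ((N - a : ℕ) : ℤ) = N - a := by omega
      simp only [this]
      ring⟩]
  have : dhtSign N ⟨N - a, by omega⟩ = -1 := by
    unfold dhtSign
    rw [if_neg (by simp; omega), if_neg (by simp; omega)]
  rw [this]
  ring

theorem dht_add (N : ℕ) (x y : Fin N → ℂ) (k : Fin N) :
    dht N (fun k => x k + y k) k = dht N x k + dht N y k := by
  unfold dht dft
  simp only [add_mul, mul_add, Finset.sum_add_distrib]

theorem dht_smul (N : ℕ) (c : ℂ) (x : Fin N → ℂ) (k : Fin N) :
    dht N (fun k => c * x k) k = c * dht N x k := by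
  unfold dht dft
  rw [Finset.mul_sum]
  refine Finset.sum_congr rfl fun n _ => ?_
  simp only [mul_assoc, ← Finset.mul_sum]
  ring

/-- The linearized Hilbert-transform phase reconstruction is exact on low-frequency
components: for the real-valued sequence `v[k] = c exp(i k ω_n) + conj c exp(-i k ω_n)`
with `0 ≤ n ≤ m - 1`, one has `f(v)[k] = v[k]` for all `k`. -/
theorem linRec_low_freq (N m : ℕ) (hNeven : Even N) (hm : 1 ≤ m) (h4m : 4 * m < N)
    (n : ℕ) (hn : n < m) (c : ℂ) (v : Fin N → ℝ)
    (hv : ∀ k : Fin N, ((v k : ℝ) : ℂ) =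
      c * Complex.exp (Complex.I * (k.val : ℂ) * ((2 * Real.pi * n / N : ℝ) : ℂ)) +
      (starRingEnd ℂ) c *
        Complex.exp (-Complex.I * (k.val : ℂ) * ((2 * Real.pi * n / N : ℝ) : ℂ))) :
    ∀ k : Fin N, linRec N m v k = v k := by
  intro k
  have hN : N ≠ 0 := by omega
  have e1 : ∀ k : Fin N,
      Complex.exp (Complex.I * (k.val : ℂ) * ((2 * Real.pi * n / N : ℝ) : ℂ))
        = Emode N n k.val := by
    intro k
    unfold Emode
    congr 1
    push_cast
    ring
  have e2 : ∀ k : Fin N,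
      Complex.exp (-Complex.I * (k.val : ℂ) * ((2 * Real.pi * n / N : ℝ) : ℂ))
        = Emode N (-n) k.val := by
    intro k
    unfold Emode
    congr 1
    push_cast
    ring
  have e3 : Complex.exp (-Complex.I * ((2 * Real.pi * m / N : ℝ) : ℂ) * (k.val : ℂ))
        = Emode N (-m) k.val := by
    unfold Emode
    congr 1
    push_cast
    ring
  have es : ∀ k : Fin N, ((Real.sin (2 * Real.pi * m / N * k.val) : ℝ) : ℂ)
      = (Emode N (-m) k.val - Emode N m k.val) * Complex.I / 2 := by
    intro k
    rw [Complex.ofReal_sin, Complex.sin]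
    unfold Emode
    congr 4 <;> push_cast <;> ring
  have hx : ∀ k : Fin N, ((v k * Real.sin (2 * Real.pi * m / N * k.val) : ℝ) : ℂ)
      = ((-c * Complex.I / 2) * Emode N (m + n) k.val
        + (-(starRingEnd ℂ) c * Complex.I / 2) * Emode N (m - n) k.val)
        + ((c * Complex.I / 2) * Emode N (-(m - n)) k.val
        + ((starRingEnd ℂ) c * Complex.I / 2) * Emode N (-(m + n)) k.val) := by
    intro k
    rw [Complex.ofReal_mul, hv, es, e1, e2,
      show (-((m : ℤ) - n)) = -m + n by ring, show (-((m : ℤ) + n)) = -m + -n by ring,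
      sub_eq_add_neg (m : ℤ)]
    simp only [Emode_add]
    ring
  have hI := Complex.I_sq
  have hone : Emode N (-m) k.val * Emode N m k.val = 1 := by
    rw [← Emode_add]
    exact Emode_period N hN _ _ (by simp)
  have key : Complex.exp (-Complex.I * ((2 * Real.pi * m / N : ℝ) : ℂ) * (k.val : ℂ)) *
      (((v k * Real.sin (2 * Real.pi * m / N * k.val) : ℝ) : ℂ) +
        Complex.I *
          dht N (fun k' => ((v k' * Real.sin (2 * Real.pi * m / N * k'.val) : ℝ) : ℂ)) k)
      = -Complex.I * (v k : ℂ) := by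
    simp only [hx]
    simp only [dht_add, dht_smul]
    rw [dht_pos N (m + n) (by omega) (by omega), dht_pos N (m - n) (by omega) (by omega),
      dht_neg N (m + n) (by omega) (by omega), dht_neg N (m - n) (by omega) (by omega),
      e3, hv, e1, e2, sub_eq_add_neg (m : ℤ) n]
    generalize Emode N (-(↑m + -↑n)) k.val = P
    generalize Emode N (-(↑m + ↑n)) k.val = Q
    simp only [Emode_add]
    have hI3 : Complex.I ^ 3 = -Complex.I := by rw [pow_succ, hI]; ring
    ring_nf
    rw [hI3]
    linear_combination (-Complex.I * c * Emode N n k.val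
      - Complex.I * (starRingEnd ℂ) c * Emode N (-n) k.val) * hone
  unfold linRec
  rw [key]
  simp
end
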